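/- Fix d ≥ 1, vectors μ₀, μ₁, q ∈ ℝ^d and a symmetric positive definite matrix Λ ∈ ℝ^{d×d} satisfying μ₀ᵀΛ⁻¹μ₀ = μ₁ᵀΛ⁻¹μ₁. For each k ≥ 1 let {(yᵢ, xᵢ)}_{i=1}^k be i.i.d. samples from P^b(μ₀, μ₁, Λ). Set μ = μ₁ − μ₀, u = 2(μ₁ + μ₀), p_k = (2/k) Σ_{i=1}^k xᵢ yᵢ, and let the trained one-layer linear Transformer's predicted probability be x̂_out = S(p_kᵀ Λ⁻¹ q), while the true posterior probability is P(x_query = 1 | y_query = q) = S(μᵀΛ⁻¹q). Then, as k → ∞, E[(S(p_kᵀΛ⁻¹q) − S(μᵀΛ⁻¹q))²] = (1/k) · (S'(μᵀΛ⁻¹q))² · [ (uᵀΛ⁻¹q)²/4 + 4 qᵀΛ⁻¹q ] + o(1/k), where the expectation is over the k i.i.d. in-context samples. -/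

import Mathlib

open MeasureTheory ProbabilityTheory Matrix Filter
open scoped ENNReal Topology

noncomputable section

/-- The sigmoid function `S(x) = 1 / (1 + exp (-x))`. -/
def S (x : ℝ) : ℝ := 1 / (1 + Real.exp (-x))

/-- Density of the `d`-dimensional Gaussian `N(μ, Λ)`. -/
def gaussianPdf (d : ℕ) (μ : Fin d → ℝ) (Λ : Matrix (Fin d) (Fin d) ℝ) (y : Fin d → ℝ) : ℝ :=
  (Real.sqrt ((2 * Real.pi) ^ d * Λ.det))⁻¹ *
    Real.exp (-((y - μ) ⬝ᵥ (Λ⁻¹ *ᵥ (y - μ))) / 2)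

/-- The `d`-dimensional Gaussian measure `N(μ, Λ)`. -/
def gaussianMeasure (d : ℕ) (μ : Fin d → ℝ) (Λ : Matrix (Fin d) (Fin d) ℝ) :
    Measure (Fin d → ℝ) :=
  volume.withDensity fun y => ENNReal.ofReal (gaussianPdf d μ Λ y)

/-- The joint law `P^b(μ₀, μ₁, Λ)` of a pair `(y, x)`: `x = ±1` with probability `1/2` each,
and conditionally on `x = -1` (resp. `x = 1`), `y ~ N(μ₀, Λ)` (resp. `N(μ₁, Λ)`). -/
def Pb (d : ℕ) (μ₀ μ₁ : Fin d → ℝ) (Λ : Matrix (Fin d) (Fin d) ℝ) :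
    Measure ((Fin d → ℝ) × ℝ) :=
  (2 : ℝ≥0∞)⁻¹ • (gaussianMeasure d μ₀ Λ).prod (Measure.dirac (-1 : ℝ)) +
    (2 : ℝ≥0∞)⁻¹ • (gaussianMeasure d μ₁ Λ).prod (Measure.dirac (1 : ℝ))

lemma S_pos (x : ℝ) : 0 < S x := by unfold S; positivity

lemma S_lt_one (x : ℝ) : S x < 1 := by
  unfold S
  rw [div_lt_one (by positivity)]
  linarith [Real.exp_pos (-x)]

lemma hasDerivAt_S (x : ℝ) : HasDerivAt S (S x * (1 - S x)) x := by
  have h : HasDerivAt (fun x : ℝ => 1 + Real.exp (-x)) (-Real.exp (-x)) x := by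
    simpa using ((hasDerivAt_neg x).exp).const_add 1
  have h0 : 1 + Real.exp (-x) ≠ 0 := by positivity
  have h2 := h.fun_inv h0
  have e : S = fun x : ℝ => (1 + Real.exp (-x))⁻¹ := by funext x; simp [S]
  have h3 : HasDerivAt S _ x := e ▸ h2
  refine h3.congr_deriv ?_
  unfold S
  field_simp
  ring

lemma abs_S_sub_le (x y : ℝ) : |S y - S x| ≤ |y - x| := by
  have := convex_univ.norm_image_sub_le_of_norm_hasDerivWithin_le (f := S) (C := 1)
    (fun x _ => (hasDerivAt_S x).hasDerivWithinAt) (fun x _ => ?_) (Set.mem_univ x)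
    (Set.mem_univ y)
  · simpa using this
  · have h1 := S_pos x
    have h2 := S_lt_one x
    rw [Real.norm_eq_abs, abs_le]
    constructor <;> nlinarith

lemma abs_deriv_S_sub_le (x y : ℝ) :
    |S y * (1 - S y) - S x * (1 - S x)| ≤ |y - x| := by
  have e : S y * (1 - S y) - S x * (1 - S x) = (S y - S x) * (1 - S x - S y) := by ring
  rw [e, abs_mul]
  have h : |1 - S x - S y| ≤ 1 := by
    rw [abs_le]
    constructor <;> linarith [S_pos x, S_pos y, S_lt_one x, S_lt_one y]
  calc _ ≤ |S y - S x| * 1 := by gcongr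
    _ ≤ _ := by simpa using abs_S_sub_le x y

lemma abs_S_sub_linear_le (a t : ℝ) :
    |S (a + t) - S a - S a * (1 - S a) * t| ≤ t ^ 2 := by
  have := (convex_closedBall (0 : ℝ) |t|).norm_image_sub_le_of_norm_hasDerivWithin_le
    (f := fun t => S (a + t) - S a * (1 - S a) * t) (C := |t|) (x := 0) (y := t)
    (f' := fun t => S (a + t) * (1 - S (a + t)) - S a * (1 - S a))
    (fun x _ => ?_) (fun x hx => ?_) (by simp) (by simp)
  · rw [Real.norm_eq_abs, Real.norm_eq_abs] at this
    simp only [add_zero, mul_zero, sub_zero, abs_mul_abs_self] at this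
    calc _ = |S (a + t) - S a * (1 - S a) * t - S a| := by ring_nf
      _ ≤ _ := this
      _ = _ := by ring
  · have h1 := (hasDerivAt_S (a + x)).comp_const_add a x
    have h2 := (hasDerivAt_id x).const_mul (S a * (1 - S a))
    simpa using (h1.fun_sub h2).hasDerivWithinAt
  · have h := abs_deriv_S_sub_le a (a + x)
    rw [add_sub_cancel_left] at h
    rw [mem_closedBall_zero_iff] at hx
    exact h.trans hx

/-- Second-order control of the squared increment of the sigmoid. -/
lemma abs_sq_S_sub_le (a t r : ℝ) (hr : 0 < r) :
    |(S (a + t) - S a) ^ 2 - deriv S a ^ 2 * t ^ 2| ≤ t ^ 2 / r + r * t ^ 4 := by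
  rw [(hasDerivAt_S a).deriv]
  set c := S a * (1 - S a)
  have hc : |c| ≤ 1 := by
    have h1 := S_pos a
    have h2 := S_lt_one a
    rw [abs_le]
    constructor <;> simp only [c] <;> nlinarith
  have h1 : |S (a + t) - S a - c * t| ≤ t ^ 2 := abs_S_sub_linear_le a t
  have h2 : |S (a + t) - S a + c * t| ≤ 2 * |t| := by
    have := abs_S_sub_le a (a + t)
    rw [add_sub_cancel_left] at this
    calc _ ≤ |S (a + t) - S a| + |c * t| := abs_add_le _ _
      _ ≤ |t| + 1 * |t| := by rw [abs_mul]; gcongr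
      _ = _ := by ring
  have e : (S (a + t) - S a) ^ 2 - c ^ 2 * t ^ 2 =
    (S (a + t) - S a - c * t) * (S (a + t) - S a + c * t) := by ring
  rw [e, abs_mul]
  calc _ ≤ t ^ 2 * (2 * |t|) := by gcongr
    _ ≤ t ^ 2 / r + r * t ^ 4 := by
      have h3 : t ^ 2 / r + r * t ^ 4 - t ^ 2 * (2 * |t|) = t ^ 2 / r * (1 - r * |t|) ^ 2 := by
        field_simp
        rw [← sq_abs t]
        ring
      have : 0 ≤ t ^ 2 / r * (1 - r * |t|) ^ 2 := by positivity
      linarith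

lemma measurable_S : Measurable S := by
  unfold S
  fun_prop

lemma integral_pow_mul_pow {Ω : Type*} [MeasurableSpace Ω] {P : Measure Ω} {A B : Ω → ℝ}
    (h : A ⟂ᵢ[P] B) (hA : MemLp A 4 P) (hB : MemLp B 4 P) (i j : ℕ) :
    ∫ ω, A ω ^ i * B ω ^ j ∂P = (∫ ω, A ω ^ i ∂P) * ∫ ω, B ω ^ j ∂P :=
  (h.comp (measurable_id.pow_const i) (measurable_id.pow_const j)).integral_fun_mul_eq_mul_integral
    (by have := hA.1; simp only [Function.comp_def, id]; fun_prop)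
    (by have := hB.1; simp only [Function.comp_def, id]; fun_prop)

section Moments

variable {Ω : Type*} [MeasurableSpace Ω] {P : Measure Ω} [IsProbabilityMeasure P]

lemma MemLp.integrable_pow_of_le {X : Ω → ℝ} {n m : ℕ} (hX : MemLp X n P) (hm : m ≤ n) :
    Integrable (fun ω => X ω ^ m) P := by
  rcases Nat.eq_zero_or_pos m with rfl | h
  · simp
  · have h1 : MemLp X m P := hX.mono_exponent (by exact_mod_cast hm)
    have h2 := h1.integrable_norm_pow h.ne'
    refine h2.congr' (by have := hX.1; fun_prop) (.of_forall fun ω => by simp)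

variable {A B : Ω → ℝ}

lemma integrable_pow_mul_pow (h : A ⟂ᵢ[P] B) (hA : MemLp A 4 P) (hB : MemLp B 4 P)
    {i j : ℕ} (hi : i ≤ 4) (hj : j ≤ 4) : Integrable (fun ω => A ω ^ i * B ω ^ j) P :=
  (h.comp (measurable_id.pow_const i) (measurable_id.pow_const j)).integrable_mul
    (MemLp.integrable_pow_of_le (n := 4) (by exact_mod_cast hA) hi)
    (MemLp.integrable_pow_of_le (n := 4) (by exact_mod_cast hB) hj)

lemma integral_add_sq_of_indepFun (h : A ⟂ᵢ[P] B) (hA : MemLp A 4 P) (hB : MemLp B 4 P)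
    (hA0 : ∫ ω, A ω ∂P = 0) :
    ∫ ω, (A ω + B ω) ^ 2 ∂P = (∫ ω, A ω ^ 2 ∂P) + ∫ ω, B ω ^ 2 ∂P := by
  have e : ∀ ω, (A ω + B ω) ^ 2 =
      A ω ^ 2 * B ω ^ 0 + 2 * (A ω ^ 1 * B ω ^ 1) + A ω ^ 0 * B ω ^ 2 := fun ω => by ring
  have I : ∀ i j : ℕ, i ≤ 4 → j ≤ 4 → Integrable (fun ω => A ω ^ i * B ω ^ j) P :=
    fun i j => integrable_pow_mul_pow h hA hB
  simp_rw [e]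
  rw [integral_add ((I 2 0 (by lia) (by lia)).fun_add ((I 1 1 (by lia) (by lia)).const_mul 2))
    (I 0 2 (by lia) (by lia)),
    integral_add (I 2 0 (by lia) (by lia)) ((I 1 1 (by lia) (by lia)).const_mul 2),
    integral_const_mul]
  simp only [integral_pow_mul_pow h hA hB]
  simp [hA0]

lemma integral_add_pow_four_of_indepFun (h : A ⟂ᵢ[P] B) (hA : MemLp A 4 P) (hB : MemLp B 4 P)
    (hA0 : ∫ ω, A ω ∂P = 0) (hB0 : ∫ ω, B ω ∂P = 0) :
    ∫ ω, (A ω + B ω) ^ 4 ∂P = (∫ ω, A ω ^ 4 ∂P) +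
      6 * ((∫ ω, A ω ^ 2 ∂P) * ∫ ω, B ω ^ 2 ∂P) + ∫ ω, B ω ^ 4 ∂P := by
  have e : ∀ ω, (A ω + B ω) ^ 4 =
      A ω ^ 4 * B ω ^ 0 + 4 * (A ω ^ 3 * B ω ^ 1) + 6 * (A ω ^ 2 * B ω ^ 2) +
        4 * (A ω ^ 1 * B ω ^ 3) + A ω ^ 0 * B ω ^ 4 := fun ω => by ring
  have I : ∀ i j : ℕ, i ≤ 4 → j ≤ 4 → Integrable (fun ω => A ω ^ i * B ω ^ j) P :=
    fun i j => integrable_pow_mul_pow h hA hB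
  have I0 := I 4 0 (by lia) (by lia)
  have I1 := (I 3 1 (by lia) (by lia)).const_mul 4
  have I2 := (I 2 2 (by lia) (by lia)).const_mul 6
  have I3 := (I 1 3 (by lia) (by lia)).const_mul 4
  have I4 := I 0 4 (by lia) (by lia)
  simp_rw [e]
  rw [integral_add (((I0.fun_add I1).fun_add I2).fun_add I3) I4,
    integral_add ((I0.fun_add I1).fun_add I2) I3, integral_add (I0.fun_add I1) I2, integral_add I0 I1]
  simp only [integral_const_mul, integral_pow_mul_pow h hA hB]
  simp [hA0, hB0]

lemma moments_sum_of_iIndepFun {ι : Type*} {X : ι → Ω → ℝ} (h : iIndepFun X P)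
    (hm : ∀ i, Measurable (X i)) (hL : ∀ i, MemLp (X i) 4 P) (h0 : ∀ i, ∫ ω, X i ω ∂P = 0)
    {V M : ℝ} (hV : ∀ i, ∫ ω, X i ω ^ 2 ∂P = V) (hM : ∀ i, ∫ ω, X i ω ^ 4 ∂P = M)
    (s : Finset ι) :
    MemLp (∑ i ∈ s, X i) 4 P ∧ ∫ ω, (∑ i ∈ s, X i) ω ∂P = 0 ∧
      ∫ ω, (∑ i ∈ s, X i) ω ^ 2 ∂P = s.card * V ∧
      ∫ ω, (∑ i ∈ s, X i) ω ^ 4 ∂P ≤ s.card * M + 3 * s.card ^ 2 * V ^ 2 := by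
  classical
  induction s using Finset.induction_on with
  | empty => simp
  | insert i s hi ih =>
    obtain ⟨ihL, ih0, ih2, ih4⟩ := ih
    have hind : (∑ j ∈ s, X j) ⟂ᵢ[P] X i := h.indepFun_finsetSum_of_notMem hm hi
    rw [Finset.sum_insert hi, add_comm (X i), Finset.card_insert_of_notMem hi]
    refine ⟨ihL.add (hL i), ?_, ?_, ?_⟩
    · simp only [Pi.add_apply]
      rw [integral_add (ihL.integrable (by norm_num)) ((hL i).integrable (by norm_num)), ih0, h0,
        add_zero]
    · simp only [Pi.add_apply]
      rw [integral_add_sq_of_indepFun hind ihL (hL i) ih0, ih2, hV]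
      push_cast
      ring
    · simp only [Pi.add_apply]
      rw [integral_add_pow_four_of_indepFun hind ihL (hL i) ih0 (h0 i), ih2, hV, hM]
      push_cast
      nlinarith [sq_nonneg V]

end Moments

/-- Delta method for the mean squared error of the sigmoid of an empirical mean. -/
lemma tendsto_mul_integral_sq_S_sub {Ω : Type*} [MeasurableSpace Ω] {P : Measure Ω}
    [IsProbabilityMeasure P] {X : Ω → ℝ} (hm : Measurable X) (hL : MemLp X 4 P)
    (h0 : ∫ ω, X ω ∂P = 0) (a : ℝ) :
    Tendsto (fun k : ℕ => (k : ℝ) * ∫ s : Fin k → Ω,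
      (S (a + (k : ℝ)⁻¹ * ∑ i, X (s i)) - S a) ^ 2 ∂(Measure.pi fun _ : Fin k => P)) atTop
      (𝓝 (deriv S a ^ 2 * ∫ ω, X ω ^ 2 ∂P)) := by
  set V := ∫ ω, X ω ^ 2 ∂P with hV
  set M := ∫ ω, X ω ^ 4 ∂P with hM
  have hbound : ∀ k : ℕ, 1 ≤ k →
      |(k : ℝ) * ∫ s : Fin k → Ω,
        (S (a + (k : ℝ)⁻¹ * ∑ i, X (s i)) - S a) ^ 2 ∂(Measure.pi fun _ : Fin k => P) -
        deriv S a ^ 2 * V| ≤ (V + (M + 3 * V ^ 2)) * (√(k : ℝ))⁻¹ := by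
    intro k hk
    have hk1 : (1 : ℝ) ≤ k := by exact_mod_cast hk
    have hk0 : (0 : ℝ) < k := by linarith
    set Q := Measure.pi fun _ : Fin k => P with hQ
    have hmp : ∀ i : Fin k, MeasurePreserving (fun s : Fin k → Ω => s i) Q P :=
      fun i => measurePreserving_eval _ i
    have hint : ∀ (i : Fin k) (n : ℕ), ∫ s, X (s i) ^ n ∂Q = ∫ ω, X ω ^ n ∂P := by
      intro i n
      conv_rhs => rw [← (hmp i).map_eq]
      rw [integral_map (hmp i).measurable.aemeasurable (by fun_prop)]
    obtain ⟨hTL, -, hT2, hT4⟩ := moments_sum_of_iIndepFun (P := Q)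
      (X := fun (i : Fin k) (s : Fin k → Ω) => X (s i))
      (iIndepFun_pi fun _ => hm.aemeasurable) (fun i => hm.comp (measurable_pi_apply i))
      (fun i => hL.comp_measurePreserving (hmp i))
      (fun i => by simpa [h0] using hint i 1) (fun i => hint i 2) (fun i => hint i 4) Finset.univ
    rw [← hV] at hT2
    rw [← hV, ← hM] at hT4
    simp only [Finset.card_univ, Fintype.card_fin, Finset.sum_apply] at hT2 hT4
    set T : (Fin k → Ω) → ℝ := fun s => (k : ℝ)⁻¹ * ∑ i, X (s i) with hT
    have hTL' : MemLp T 4 Q := by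
      have := hTL.const_mul (k : ℝ)⁻¹
      simpa [hT, Finset.sum_apply] using this
    have hTm : Measurable T := by fun_prop
    have hI2 : Integrable (fun s => T s ^ 2) Q :=
      MemLp.integrable_pow_of_le (n := 4) (by exact_mod_cast hTL') (by lia)
    have hI4 : Integrable (fun s => T s ^ 4) Q :=
      MemLp.integrable_pow_of_le (n := 4) (by exact_mod_cast hTL') (by lia)
    have hT2' : ∫ s, T s ^ 2 ∂Q = V / k := by
      simp only [hT, mul_pow]
      rw [integral_const_mul, hT2]
      field_simp
    have hT4' : ∫ s, T s ^ 4 ∂Q ≤ (M + 3 * V ^ 2) / k ^ 2 := by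
      simp only [hT, mul_pow]
      rw [integral_const_mul]
      have hM0 : 0 ≤ M := integral_nonneg fun ω => by positivity
      calc _ ≤ ((k : ℝ)⁻¹) ^ 4 * (k ^ 2 * (M + 3 * V ^ 2)) := by
            gcongr
            nlinarith [mul_nonneg hM0 (mul_nonneg hk0.le (sub_nonneg.2 hk1))]
        _ = _ := by field_simp
    have hIF : Integrable (fun s => (S (a + T s) - S a) ^ 2) Q := by
      refine hI2.mono' ?_ (.of_forall fun s => ?_)
      · have := measurable_S
        exact (by fun_prop : Measurable fun s => (S (a + T s) - S a) ^ 2).aestronglyMeasurable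
      · have := abs_S_sub_le a (a + T s)
        rw [add_sub_cancel_left] at this
        rw [Real.norm_eq_abs, abs_of_nonneg (sq_nonneg _)]
        exact sq_le_sq.2 this
    have hr : 0 < √(k : ℝ) := Real.sqrt_pos.2 hk0
    have hrr : √(k : ℝ) ^ 2 = k := Real.sq_sqrt hk0.le
    have key : |∫ s, ((S (a + T s) - S a) ^ 2 - deriv S a ^ 2 * T s ^ 2) ∂Q| ≤
        (V / k) / √(k : ℝ) + √(k : ℝ) * ((M + 3 * V ^ 2) / k ^ 2) := by
      calc _ ≤ ∫ s, |(S (a + T s) - S a) ^ 2 - deriv S a ^ 2 * T s ^ 2| ∂Q :=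
            abs_integral_le_integral_abs
        _ ≤ ∫ s, (T s ^ 2 / √(k : ℝ) + √(k : ℝ) * T s ^ 4) ∂Q := by
            refine integral_mono (hIF.sub (hI2.const_mul _)).abs
              ((hI2.div_const _).add (hI4.const_mul _)) fun s => abs_sq_S_sub_le a (T s) _ hr
        _ = (∫ s, T s ^ 2 ∂Q) / √(k : ℝ) + √(k : ℝ) * ∫ s, T s ^ 4 ∂Q := by
            rw [integral_add (hI2.div_const _) (hI4.const_mul _), integral_div, integral_const_mul]
        _ ≤ _ := by rw [hT2']; gcongr
    rw [integral_sub hIF (hI2.const_mul _), integral_const_mul, hT2'] at key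
    have e : (k : ℝ) * ∫ s, (S (a + T s) - S a) ^ 2 ∂Q - deriv S a ^ 2 * V =
        k * ((∫ s, (S (a + T s) - S a) ^ 2 ∂Q) - deriv S a ^ 2 * (V / k)) := by
      field_simp
    rw [e, abs_mul, abs_of_pos hk0]
    calc _ ≤ (k : ℝ) * ((V / k) / √(k : ℝ) + √(k : ℝ) * ((M + 3 * V ^ 2) / k ^ 2)) := by gcongr
      _ = V / √(k : ℝ) + √(k : ℝ) * (M + 3 * V ^ 2) / k := by field_simp
      _ = V / √(k : ℝ) + √(k : ℝ) * (M + 3 * V ^ 2) / √(k : ℝ) ^ 2 := by rw [hrr]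
      _ = _ := by field_simp
  rw [tendsto_iff_dist_tendsto_zero]
  simp_rw [Real.dist_eq]
  refine squeeze_zero' (.of_forall fun _ => abs_nonneg _) ((eventually_ge_atTop 1).mono hbound) ?_
  have : Tendsto (fun k : ℕ => (√(k : ℝ))⁻¹) atTop (𝓝 0) :=
    tendsto_inv_atTop_zero.comp (Real.tendsto_sqrt_atTop.comp tendsto_natCast_atTop_atTop)
  simpa using this.const_mul (V + (M + 3 * V ^ 2))

section Gaussian

variable {d : ℕ} {Λ : Matrix (Fin d) (Fin d) ℝ}

open scoped MatrixOrder in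
lemma integral_exp_neg_quadratic_form (hΛ : Λ.PosDef) :
    ∫ y : Fin d → ℝ, Real.exp (-(y ⬝ᵥ (Λ⁻¹ *ᵥ y)) / 2) = √((2 * Real.pi) ^ d * Λ.det) := by
  obtain ⟨C, hC, hCC⟩ := CStarAlgebra.isStrictlyPositive_iff_eq_star_mul_self.mp
    hΛ.inv.isStrictlyPositive
  have hCdet : C.det ≠ 0 := by
    rw [Matrix.isUnit_iff_isUnit_det] at hC
    exact hC.ne_zero
  have hquad : ∀ y : Fin d → ℝ, y ⬝ᵥ (Λ⁻¹ *ᵥ y) = ∑ i, (C *ᵥ y) i ^ 2 := by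
    intro y
    rw [hCC, star_eq_conjTranspose, conjTranspose_eq_transpose_of_trivial, ← mulVec_mulVec,
      dotProduct_mulVec, vecMul_transpose]
    simp [dotProduct, sq]
  have hdet : Λ.det = (C.det⁻¹) ^ 2 := by
    have h1 : Λ⁻¹.det = C.det ^ 2 := by
      rw [hCC, star_eq_conjTranspose, conjTranspose_eq_transpose_of_trivial, det_mul,
        det_transpose, sq]
    rw [det_nonsing_inv, Ring.inverse_eq_inv'] at h1
    rw [inv_pow, ← h1, inv_inv]
  have hmap := Real.map_matrix_volume_pi_eq_smul_volume_pi hCdet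
  have hcont : Continuous fun z : Fin d → ℝ => ∏ i, Real.exp (-(1 / 2) * z i ^ 2) := by fun_prop
  calc _ = ∫ y : Fin d → ℝ, (fun z : Fin d → ℝ => ∏ i, Real.exp (-(1 / 2) * z i ^ 2))
        (toLin' C y) := by
        congr with y
        dsimp only
        rw [hquad, ← Real.exp_sum, toLin'_apply, ← Finset.mul_sum]
        ring_nf
    _ = ∫ z, ∏ i, Real.exp (-(1 / 2) * z i ^ 2) ∂(Measure.map (toLin' C) volume) := by
        rw [integral_map (by fun_prop) hcont.aestronglyMeasurable]
    _ = |C.det⁻¹| * √(2 * Real.pi) ^ d := by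
        rw [hmap, integral_smul_measure, ENNReal.toReal_ofReal (abs_nonneg _),
          integral_fintype_prod_volume_eq_prod (fun _ x => Real.exp (-(1 / 2) * x ^ 2))]
        simp only [integral_gaussian, Finset.prod_const, Finset.card_univ, Fintype.card_fin,
          smul_eq_mul]
        congr 3
        ring
    _ = _ := by
        rw [hdet, Real.sqrt_mul (by positivity) (C.det⁻¹ ^ 2), Real.sqrt_sq_eq_abs, mul_comm]
        congr 1
        rw [eq_comm, Real.sqrt_eq_iff_mul_self_eq (by positivity) (by positivity), ← mul_pow,
          Real.mul_self_sqrt (by positivity)]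

lemma gaussianPdf_nonneg (μ y : Fin d → ℝ) : 0 ≤ gaussianPdf d μ Λ y := by
  unfold gaussianPdf
  positivity

lemma measurable_gaussianPdf (μ : Fin d → ℝ) : Measurable (gaussianPdf d μ Λ) := by
  unfold gaussianPdf
  have : Continuous fun y : Fin d → ℝ => (√((2 * Real.pi) ^ d * Λ.det))⁻¹ *
      Real.exp (-((y - μ) ⬝ᵥ (Λ⁻¹ *ᵥ (y - μ))) / 2) := by
    fun_prop
  exact this.measurable

lemma integral_gaussianPdf (hΛ : Λ.PosDef) (μ : Fin d → ℝ) :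
    ∫ y, gaussianPdf d μ Λ y = 1 := by
  unfold gaussianPdf
  rw [integral_const_mul,
    integral_sub_right_eq_self (fun y : Fin d → ℝ => Real.exp (-(y ⬝ᵥ (Λ⁻¹ *ᵥ y)) / 2)) μ,
    integral_exp_neg_quadratic_form hΛ]
  have := hΛ.det_pos
  exact inv_mul_cancel₀ (by positivity)

lemma isProbabilityMeasure_gaussianMeasure (hΛ : Λ.PosDef) (μ : Fin d → ℝ) :
    IsProbabilityMeasure (gaussianMeasure d μ Λ) := by
  constructor
  rw [gaussianMeasure, withDensity_apply _ .univ, Measure.restrict_univ,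
    ← ofReal_integral_eq_lintegral_ofReal
      (integrable_of_integral_eq_one (integral_gaussianPdf hΛ μ))
      (.of_forall (gaussianPdf_nonneg μ)), integral_gaussianPdf hΛ, ENNReal.ofReal_one]

lemma exp_mul_gaussianPdf (hΛ : Λ.PosDef) (μ v y : Fin d → ℝ) (t : ℝ) :
    gaussianPdf d μ Λ y * Real.exp (t * (y ⬝ᵥ v)) =
      Real.exp ((μ ⬝ᵥ v) * t + (v ⬝ᵥ (Λ *ᵥ v)) * t ^ 2 / 2) *
        gaussianPdf d (μ + t • (Λ *ᵥ v)) Λ y := by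
  have hdet : IsUnit Λ.det := hΛ.det_pos.ne'.isUnit
  have hsymm : Λᵀ = Λ := by
    have := hΛ.isHermitian.eq
    rwa [conjTranspose_eq_transpose_of_trivial] at this
  unfold gaussianPdf
  rw [mul_assoc, mul_left_comm (Real.exp (μ ⬝ᵥ v * t + _)), ← Real.exp_add, ← Real.exp_add]
  congr 2
  obtain ⟨z, rfl⟩ : ∃ z, y = z + μ := ⟨y - μ, by simp⟩
  have h1 : Λ⁻¹ *ᵥ (Λ *ᵥ v) = v := by rw [mulVec_mulVec, nonsing_inv_mul _ hdet, one_mulVec]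
  have h2 : (Λ *ᵥ v) ⬝ᵥ (Λ⁻¹ *ᵥ z) = z ⬝ᵥ v := by
    rw [← vecMul_transpose, hsymm, ← dotProduct_mulVec, mulVec_mulVec, mul_nonsing_inv _ hdet,
      one_mulVec, dotProduct_comm]
  have h3 : z + μ - (μ + t • (Λ *ᵥ v)) = z - t • (Λ *ᵥ v) := by abel
  rw [h3, add_sub_cancel_right]
  simp only [mulVec_sub, mulVec_smul, sub_dotProduct, dotProduct_sub, smul_dotProduct,
    dotProduct_smul, smul_eq_mul, h1, h2, add_dotProduct, dotProduct_comm (Λ *ᵥ v) v]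
  ring

lemma mgf_dotProduct_gaussianMeasure (hΛ : Λ.PosDef) (μ v : Fin d → ℝ) (t : ℝ) :
    mgf (fun y => y ⬝ᵥ v) (gaussianMeasure d μ Λ) t =
      Real.exp ((μ ⬝ᵥ v) * t + (v ⬝ᵥ (Λ *ᵥ v)) * t ^ 2 / 2) := by
  rw [mgf, gaussianMeasure, integral_withDensity_eq_integral_toReal_smul
    (measurable_gaussianPdf μ).ennreal_ofReal (.of_forall fun _ => ENNReal.ofReal_lt_top)]
  simp_rw [ENNReal.toReal_ofReal (gaussianPdf_nonneg μ _), smul_eq_mul, exp_mul_gaussianPdf hΛ]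
  rw [integral_const_mul, integral_gaussianPdf hΛ, mul_one]

/-- Linear functionals of a nondegenerate Gaussian vector are Gaussian. -/
lemma map_dotProduct_gaussianMeasure (hΛ : Λ.PosDef) (μ v : Fin d → ℝ) :
    (gaussianMeasure d μ Λ).map (fun y => y ⬝ᵥ v) =
      gaussianReal (μ ⬝ᵥ v) (v ⬝ᵥ (Λ *ᵥ v)).toNNReal := by
  have := isProbabilityMeasure_gaussianMeasure hΛ μ
  have hv : 0 ≤ v ⬝ᵥ (Λ *ᵥ v) := by simpa using hΛ.posSemidef.dotProduct_mulVec_nonneg v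
  have hmgf : mgf (fun y => y ⬝ᵥ v) (gaussianMeasure d μ Λ) =
      mgf id (gaussianReal (μ ⬝ᵥ v) (v ⬝ᵥ (Λ *ᵥ v)).toNNReal) := by
    funext t
    rw [mgf_dotProduct_gaussianMeasure hΛ, mgf_id_gaussianReal, Real.coe_toNNReal _ hv]
  have hmeas : Measurable fun y : Fin d → ℝ => y ⬝ᵥ v := by
    unfold dotProduct
    fun_prop
  rw [Measure.ext_of_complexMGF_eq hmeas.aemeasurable aemeasurable_id (μ' := gaussianReal _ _)
    ?_, Measure.map_id]
  funext z
  refine eqOn_complexMGF_of_mgf hmgf ?_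
  simp [integrableExpSet_eq_of_mgf hmgf]

end Gaussian

section LabelledGaussian

variable {d : ℕ} {Λ : Matrix (Fin d) (Fin d) ℝ}

lemma isProbabilityMeasure_Pb (hΛ : Λ.PosDef) (μ₀ μ₁ : Fin d → ℝ) :
    IsProbabilityMeasure (Pb d μ₀ μ₁ Λ) := by
  have h0 := isProbabilityMeasure_gaussianMeasure hΛ μ₀
  have h1 := isProbabilityMeasure_gaussianMeasure hΛ μ₁
  constructor
  simp [Pb, ENNReal.inv_two_add_inv_two]

/-- The law of `x * (y ⬝ᵥ v)` is a mixture of two one-dimensional Gaussians. -/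
lemma measurePreserving_label_mul_dotProduct (hΛ : Λ.PosDef) (μ₀ μ₁ v : Fin d → ℝ) :
    MeasurePreserving (fun s : (Fin d → ℝ) × ℝ => s.2 * (s.1 ⬝ᵥ v)) (Pb d μ₀ μ₁ Λ)
      ((2 : ℝ≥0∞)⁻¹ • gaussianReal (-(μ₀ ⬝ᵥ v)) (v ⬝ᵥ (Λ *ᵥ v)).toNNReal +
        (2 : ℝ≥0∞)⁻¹ • gaussianReal (μ₁ ⬝ᵥ v) (v ⬝ᵥ (Λ *ᵥ v)).toNNReal) := by
  have h0 := isProbabilityMeasure_gaussianMeasure hΛ μ₀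
  have h1 := isProbabilityMeasure_gaussianMeasure hΛ μ₁
  have hm : Measurable fun s : (Fin d → ℝ) × ℝ => s.2 * (s.1 ⬝ᵥ v) := by
    unfold dotProduct
    fun_prop
  have hd : Measurable fun y : Fin d → ℝ => y ⬝ᵥ v := by
    unfold dotProduct
    fun_prop
  have hpair : ∀ x : ℝ, Measurable fun y : Fin d → ℝ => (y, x) := fun x => by fun_prop
  refine ⟨hm, ?_⟩
  rw [Pb, Measure.map_add _ _ hm, Measure.map_smul, Measure.map_smul, Measure.prod_dirac,
    Measure.prod_dirac, Measure.map_map hm (hpair _), Measure.map_map hm (hpair _),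
    ← gaussianReal_map_neg, ← map_dotProduct_gaussianMeasure hΛ, ← map_dotProduct_gaussianMeasure hΛ,
    Measure.map_map measurable_neg hd]
  simp [Function.comp_def]

end LabelledGaussian

lemma integral_half_add_half {α : Type*} [MeasurableSpace α] {ν₁ ν₂ : Measure α} {g : α → ℝ}
    (h₁ : Integrable g ν₁) (h₂ : Integrable g ν₂) :
    ∫ z, g z ∂((2 : ℝ≥0∞)⁻¹ • ν₁ + (2 : ℝ≥0∞)⁻¹ • ν₂) =
      ((∫ z, g z ∂ν₁) + ∫ z, g z ∂ν₂) / 2 := by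
  rw [integral_add_measure (h₁.smul_measure (by simp)) (h₂.smul_measure (by simp)),
    integral_smul_measure, integral_smul_measure]
  simp
  ring

section GaussianReal

variable (a m : ℝ) (w : NNReal)

lemma integrable_affine_gaussianReal :
    Integrable (fun z : ℝ => 2 * z - a) (gaussianReal m w) :=
  (((memLp_id_gaussianReal' 1 (by norm_num)).integrable le_rfl).const_mul 2).sub
    (integrable_const a)

lemma integral_affine_gaussianReal : ∫ z, (2 * z - a) ∂(gaussianReal m w) = 2 * m - a := by
  have h : Integrable (fun z : ℝ => z) (gaussianReal m w) :=
    (memLp_id_gaussianReal' 1 (by norm_num)).integrable le_rfl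
  rw [integral_sub (h.const_mul 2) (integrable_const a), integral_const_mul,
    integral_id_gaussianReal]
  simp

lemma integrable_affine_sq_gaussianReal :
    Integrable (fun z : ℝ => (2 * z - a) ^ 2) (gaussianReal m w) :=
  (((memLp_id_gaussianReal' 2 (by norm_num)).const_mul 2).sub (memLp_const a)).integrable_sq

lemma integral_affine_sq_gaussianReal :
    ∫ z, (2 * z - a) ^ 2 ∂(gaussianReal m w) = 4 * w + (2 * m - a) ^ 2 := by
  have hL : MemLp (fun z : ℝ => 2 * z - a) 2 (gaussianReal m w) :=
    ((memLp_id_gaussianReal' 2 (by norm_num)).const_mul 2).sub (memLp_const a)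
  have h := variance_eq_sub hL
  have hv : Var[fun z : ℝ => 2 * z - a; gaussianReal m w] = 4 * w := by
    rw [variance_sub_const (by fun_prop), variance_const_mul, variance_fun_id_gaussianReal]
    norm_num
  rw [hv, integral_affine_gaussianReal] at h
  simp only [Pi.pow_apply] at h
  linarith

end GaussianReal

/-- With `μ = μ₁ - μ₀`, `u = 2(μ₁ + μ₀)`, `p_k = (2/k) ∑ᵢ xᵢ yᵢ` for `k`
i.i.d. samples from `P^b(μ₀, μ₁, Λ)`, the mean squared difference between the trained
Transformer's soft prediction `S(p_kᵀ Λ⁻¹ q)` and the true posterior `S(μᵀ Λ⁻¹ q)` equals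
`(1/k) (S'(μᵀΛ⁻¹q))² [(uᵀΛ⁻¹q)²/4 + 4 qᵀΛ⁻¹q] + o(1/k)`, i.e. `k` times the expectation
converges to the displayed constant. -/
theorem stmt0 (d : ℕ) (hd : 1 ≤ d) (μ₀ μ₁ q : Fin d → ℝ)
    (Λ : Matrix (Fin d) (Fin d) ℝ) (hΛ : Λ.PosDef)
    (hμ : μ₀ ⬝ᵥ (Λ⁻¹ *ᵥ μ₀) = μ₁ ⬝ᵥ (Λ⁻¹ *ᵥ μ₁)) :
    Tendsto
      (fun k : ℕ =>
        (k : ℝ) *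
          ∫ s : Fin k → (Fin d → ℝ) × ℝ,
            (S ((((2 : ℝ) / k) • ∑ i, (s i).2 • (s i).1) ⬝ᵥ (Λ⁻¹ *ᵥ q)) -
                S ((μ₁ - μ₀) ⬝ᵥ (Λ⁻¹ *ᵥ q))) ^ 2
            ∂(Measure.pi fun _ : Fin k => Pb d μ₀ μ₁ Λ))
      atTop
      (𝓝 ((deriv S ((μ₁ - μ₀) ⬝ᵥ (Λ⁻¹ *ᵥ q))) ^ 2 *
        ((((2 : ℝ) • (μ₁ + μ₀)) ⬝ᵥ (Λ⁻¹ *ᵥ q)) ^ 2 / 4 + 4 * (q ⬝ᵥ (Λ⁻¹ *ᵥ q))))) := by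
  have hΛdet : IsUnit Λ.det := hΛ.det_pos.ne'.isUnit
  set v := Λ⁻¹ *ᵥ q with hv
  have hσ : v ⬝ᵥ (Λ *ᵥ v) = q ⬝ᵥ v := by
    rw [hv, mulVec_mulVec, mul_nonsing_inv _ hΛdet, one_mulVec, dotProduct_comm]
  have hσ0 : 0 ≤ q ⬝ᵥ v := by
    simpa [hσ] using hΛ.posSemidef.dotProduct_mulVec_nonneg v
  have hP := isProbabilityMeasure_Pb hΛ μ₀ μ₁
  have hmp := measurePreserving_label_mul_dotProduct hΛ μ₀ μ₁ v
  have hσ' : ((v ⬝ᵥ (Λ *ᵥ v)).toNNReal : ℝ) = q ⬝ᵥ v := by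
    rw [hσ, Real.coe_toNNReal _ hσ0]
  set ν := (2 : ℝ≥0∞)⁻¹ • gaussianReal (-(μ₀ ⬝ᵥ v)) (v ⬝ᵥ (Λ *ᵥ v)).toNNReal +
      (2 : ℝ≥0∞)⁻¹ • gaussianReal (μ₁ ⬝ᵥ v) (v ⬝ᵥ (Λ *ᵥ v)).toNNReal with hν
  set a := (μ₁ - μ₀) ⬝ᵥ v with ha
  have ha' : a = μ₁ ⬝ᵥ v - μ₀ ⬝ᵥ v := sub_dotProduct _ _ _
  have hint : ∀ g : ℝ → ℝ, Continuous g → ∫ s, g (s.2 * (s.1 ⬝ᵥ v)) ∂(Pb d μ₀ μ₁ Λ) =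
      ∫ z, g z ∂ν := by
    intro g hg
    rw [← hmp.map_eq, integral_map hmp.measurable.aemeasurable hg.aestronglyMeasurable]
  have hLν : MemLp (fun z : ℝ => 2 * z - a) 4 ν := by
    have hL : ∀ m w, MemLp (fun z : ℝ => 2 * z - a) 4 (gaussianReal m w) := fun m w =>
      ((memLp_id_gaussianReal' 4 (by norm_num)).const_mul 2).sub (memLp_const a)
    have hI : ∀ m w, Integrable (fun z : ℝ => ‖2 * z - a‖ ^ (4 : ℝ≥0∞).toReal)
        (gaussianReal m w) := fun m w =>
      (integrable_norm_rpow_iff (hL m w).1 (by norm_num) (by norm_num)).2 (hL m w)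
    rw [← integrable_norm_rpow_iff (by fun_prop) (by norm_num) (by norm_num), hν]
    exact ((hI _ _).smul_measure (by simp)).add_measure ((hI _ _).smul_measure (by simp))
  have hL := hLν.comp_measurePreserving hmp
  have h0 : ∫ s, (2 * (s.2 * (s.1 ⬝ᵥ v)) - a) ∂(Pb d μ₀ μ₁ Λ) = 0 := by
    rw [hint (fun z => 2 * z - a) (by fun_prop), hν, integral_half_add_half,
      integral_affine_gaussianReal, integral_affine_gaussianReal, ha']
    · ring
    all_goals exact integrable_affine_gaussianReal _ _ _
  have h2 : ∫ s, (2 * (s.2 * (s.1 ⬝ᵥ v)) - a) ^ 2 ∂(Pb d μ₀ μ₁ Λ) =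
      (μ₁ ⬝ᵥ v + μ₀ ⬝ᵥ v) ^ 2 + 4 * (q ⬝ᵥ v) := by
    rw [hint (fun z => (2 * z - a) ^ 2) (by fun_prop), hν, integral_half_add_half,
      integral_affine_sq_gaussianReal, integral_affine_sq_gaussianReal, ha', hσ']
    · ring
    all_goals exact integrable_affine_sq_gaussianReal _ _ _
  have main := tendsto_mul_integral_sq_S_sub (by have := hmp.measurable; fun_prop) hL h0 a
  have hlim : deriv S a ^ 2 * ((((2 : ℝ) • (μ₁ + μ₀)) ⬝ᵥ v) ^ 2 / 4 + 4 * (q ⬝ᵥ v)) =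
      deriv S a ^ 2 * ∫ s, (2 * (s.2 * (s.1 ⬝ᵥ v)) - a) ^ 2 ∂(Pb d μ₀ μ₁ Λ) := by
    rw [h2, smul_dotProduct, add_dotProduct, smul_eq_mul]
    ring
  rw [hlim]
  refine main.congr' ((eventually_ge_atTop 1).mono fun k hk => ?_)
  have hk0 : (k : ℝ) ≠ 0 := by
    have : (1 : ℝ) ≤ k := by exact_mod_cast hk
    positivity
  dsimp only
  congr 2
  funext s
  congr 3
  rw [smul_dotProduct, sum_dotProduct]
  simp only [Function.comp_apply, smul_dotProduct, smul_eq_mul, Finset.sum_sub_distrib,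
    ← Finset.mul_sum, Finset.sum_const, Finset.card_univ, Fintype.card_fin, nsmul_eq_mul]
  field_simp
  ring
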